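/- arXiv:1007.2616 — 2 statements merged into one kernel-verified Lean document; each statement's English description precedes it below -/
import Mathlib

section
/- Let $A$ be a C*-algebra, $\kappa : C \to M(A)$ a nondegenerate homomorphism, and equip $M_C(A) = \{m \in M(A) : \kappa(C)m \cup m\kappa(C) \subseteq A\}$ with the $C$-strict topology generated by the seminorms $m \mapsto \|\kappa(c)m\|$ and $m \mapsto \|m\kappa(c)\|$ for $c \in C$. Then: (1) the $C$-strict topology on $M_C(A)$ is finer than the relative strict topology from $M(A)$; (2) $A$ is $C$-strictly dense in $M_C(A)$; (3) $M_C(A)$ is $C$-strictly complete, i.e., every $C$-strictly Cauchy net in $M_C(A)$ converges $C$-strictly in $M_C(A)$. -/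
open scoped MultiplierAlgebra

/-- The strict uniformity on `M(A)`, generated by the seminorms `m ↦ ‖am‖`, `m ↦ ‖ma‖`
for `a ∈ A`. -/
noncomputable def strictUniformity (A : Type*) [NonUnitalCStarAlgebra A] :
    UniformSpace 𝓜(ℂ, A) :=
  ⨅ a : A, UniformSpace.comap (fun m => (a : 𝓜(ℂ, A)) * m) inferInstance ⊓
    UniformSpace.comap (fun m => m * (a : 𝓜(ℂ, A))) inferInstance

/-- The `C`-strict uniformity on `M(A)` associated to a homomorphism `κ : C → M(A)`,
generated by the seminorms `m ↦ ‖κ(c)m‖`, `m ↦ ‖mκ(c)‖` for `c ∈ C`. -/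
noncomputable def cStrictUniformity {A C : Type*} [NonUnitalCStarAlgebra A]
    [NonUnitalCStarAlgebra C] (κ : C →⋆ₙₐ[ℂ] 𝓜(ℂ, A)) : UniformSpace 𝓜(ℂ, A) :=
  ⨅ c : C, UniformSpace.comap (fun m => κ c * m) inferInstance ⊓
    UniformSpace.comap (fun m => m * κ c) inferInstance

/-- The `C`-multiplier algebra `M_C(A) = {m ∈ M(A) : κ(C)m ∪ mκ(C) ⊆ A}`. -/
def MCset {A C : Type*} [NonUnitalCStarAlgebra A] [NonUnitalCStarAlgebra C]
    (κ : C →⋆ₙₐ[ℂ] 𝓜(ℂ, A)) : Set 𝓜(ℂ, A) :=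
  {m : 𝓜(ℂ, A) | ∀ c : C,
    (∃ a : A, κ c * m = (a : 𝓜(ℂ, A))) ∧ (∃ a : A, m * κ c = (a : 𝓜(ℂ, A)))}


section aux
open Filter Topology

lemma aux_inv {B : Type*} [CStarAlgebra B] [PartialOrder B] [StarOrderedRing B]
    (y : B) (hy : 0 ≤ y) (r : ℝ) (hr : 0 < r) :
    IsUnit (y + algebraMap ℝ B r) ∧ ‖Ring.inverse (y + algebraMap ℝ B r)‖ ≤ r⁻¹ := by
  have hu : IsUnit (algebraMap ℝ B r) := (IsUnit.mk0 r hr.ne').map (algebraMap ℝ B)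
  have hle : algebraMap ℝ B r ≤ y + algebraMap ℝ B r := le_add_of_nonneg_left hy
  have h0 : 0 ≤ algebraMap ℝ B r := algebraMap_nonneg B hr.le
  have hsp : IsStrictlyPositive (algebraMap ℝ B r) := ⟨h0, hu⟩
  have h1 : IsUnit (y + algebraMap ℝ B r) := CStarAlgebra.isUnit_of_le _ hle hsp
  refine ⟨h1, ?_⟩
  let R : Bˣ := Units.map (algebraMap ℝ B : ℝ →* B) (Units.mk0 r hr.ne')
  obtain ⟨u, hu'⟩ := h1
  have hRu : (R : B) ≤ u := by rw [hu']; exact hle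
  have h2 : ((u⁻¹ : Bˣ) : B) ≤ ((R⁻¹ : Bˣ) : B) := CStarAlgebra.inv_le_inv (a := R) h0 hRu
  have h3 : (0 : B) ≤ ((u⁻¹ : Bˣ) : B) :=
    CFC.inv_nonneg_of_nonneg u (by rw [hu']; exact h0.trans hle)
  rw [← hu', Ring.inverse_unit]
  refine (CStarAlgebra.norm_le_norm_of_nonneg_of_le h3 h2).trans ?_
  have : ((R⁻¹ : Bˣ) : B) = algebraMap ℝ B r⁻¹ := rfl
  rw [this, Algebra.algebraMap_eq_smul_one, norm_smul, Real.norm_of_nonneg (by positivity)]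
  rcases subsingleton_or_nontrivial B with h | h
  · rw [Subsingleton.elim (1 : B) 0]; simp; positivity
  · simp

lemma aux_cont {B C : Type*} [CStarAlgebra B] [NonUnitalCStarAlgebra C]
    (κ : C →⋆ₙₐ[ℂ] B) : Continuous κ :=
  AddMonoidHomClass.continuous_of_bound κ 1 fun x => by
    simpa using NonUnitalStarAlgHom.norm_apply_le κ x

lemma aux_cohen {B C : Type*} [CStarAlgebra B] [PartialOrder B] [StarOrderedRing B]
    [NonUnitalCStarAlgebra C] [PartialOrder C] [StarOrderedRing C]
    (κ : C →⋆ₙₐ[ℂ] B) (P : Set B) (hPc : IsClosed P) (hPm : ∀ x, ∀ b ∈ P, x * b ∈ P)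
    (hP : ∀ b ∈ P, ∀ ε > (0 : ℝ), ∃ e : C, 0 ≤ e ∧ ‖e‖ ≤ 1 ∧ ‖b - κ e * b‖ ≤ ε)
    (a : B) (ha : a ∈ P) : ∃ c : C, ∃ b ∈ P, a = κ c * b := by
  have hex : ∀ (b : B) (n : ℕ), ∃ e : C, 0 ≤ e ∧ ‖e‖ ≤ 1 ∧ (b ∈ P → ‖b - κ e * b‖ ≤ (1/2 : ℝ)^n) := by
    intro b n
    by_cases hb : b ∈ P
    · obtain ⟨e, h1, h2, h3⟩ := hP b hb ((1/2)^n) (by positivity)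
      exact ⟨e, h1, h2, fun _ => h3⟩
    · exact ⟨0, le_rfl, by simp, fun h => (hb h).elim⟩
  choose e he0 he1 he using hex
  let q : ℕ → C → B := fun n s => κ s + algebraMap ℝ B ((1/2)^n)
  let s : ℕ → C := fun n => Nat.rec 0
    (fun n t => t + ((1/2 : ℝ)^(n+1)) • e (Ring.inverse (q n t) * a) n) n
  let b : ℕ → B := fun n => Ring.inverse (q n (s n)) * a
  have hs : ∀ n, s (n+1) = s n + ((1/2 : ℝ)^(n+1)) • e (b n) n := fun n => rfl
  have hs0 : ∀ n, 0 ≤ s n := by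
    intro n
    induction n with
    | zero => exact le_rfl
    | succ n ih =>
      rw [hs]
      exact add_nonneg ih (smul_nonneg (by positivity) (he0 _ _))
  have hκ0 : ∀ n, 0 ≤ κ (s n) := fun n => map_nonneg κ (hs0 n)
  have hinv := fun n => aux_inv (κ (s n)) (hκ0 n) ((1/2)^n) (by positivity)
  have hbP : ∀ n, b n ∈ P := fun n => hPm _ _ ha
  have hab : ∀ n, q n (s n) * b n = a := fun n => Ring.mul_inverse_cancel_left _ _ (hinv n).1
  have hκs : ∀ (r : ℝ) (x : C), κ (r • x) = r • κ x := by
    intro r x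
    have := map_smul κ (r : ℂ) x
    simpa using this
  have hq : ∀ n, q n (s n) - q (n+1) (s (n+1)) = ((1/2 : ℝ)^(n+1)) • (1 - κ (e (b n) n)) := by
    intro n
    simp only [q, hs, map_add, hκs, Algebra.algebraMap_eq_smul_one, smul_sub]
    have : ((1/2 : ℝ)^n) • (1 : B) = ((1/2 : ℝ)^(n+1)) • (1 : B) + ((1/2 : ℝ)^(n+1)) • (1 : B) := by
      rw [← add_smul]; congr 1; ring
    rw [this]; abel
  have hbd : ∀ n, b (n+1) - b n =
      Ring.inverse (q (n+1) (s (n+1))) * (((1/2 : ℝ)^(n+1)) • (b n - κ (e (b n) n) * b n)) := by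
    intro n
    have : ((1/2 : ℝ)^(n+1)) • (b n - κ (e (b n) n) * b n) = a - q (n+1) (s (n+1)) * b n := by
      rw [← hab n, ← sub_mul, hq n, smul_mul_assoc, sub_mul, one_mul]
    rw [this, mul_sub, Ring.inverse_mul_cancel_left _ _ (hinv (n+1)).1]
  have hbn : ∀ n, ‖b (n+1) - b n‖ ≤ 1 * (1/2 : ℝ)^n := by
    intro n
    rw [hbd]
    refine (norm_mul_le _ _).trans ?_
    rw [norm_smul, Real.norm_of_nonneg (by positivity), ← mul_assoc]
    refine mul_le_mul ?_ (he _ _ (hbP n)) (norm_nonneg _) zero_le_one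
    calc _ ≤ ((1/2 : ℝ)^(n+1))⁻¹ * (1/2 : ℝ)^(n+1) := by
            gcongr
            exact (hinv (n+1)).2
      _ = 1 := inv_mul_cancel₀ (by positivity)
  have hsn : ∀ n, ‖s (n+1) - s n‖ ≤ 1 * (1/2 : ℝ)^n := by
    intro n
    rw [hs, add_sub_cancel_left, norm_smul, Real.norm_of_nonneg (by positivity), pow_succ]
    have := he1 (b n) n
    have h2 : (0 : ℝ) < (1/2)^n := by positivity
    nlinarith [norm_nonneg (e (b n) n)]
  have cb : CauchySeq b := cauchySeq_of_le_geometric (1/2) 1 (by norm_num)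
    (fun n => by rw [dist_comm, dist_eq_norm]; exact hbn n)
  have cs : CauchySeq s := cauchySeq_of_le_geometric (1/2) 1 (by norm_num)
    (fun n => by rw [dist_comm, dist_eq_norm]; exact hsn n)
  obtain ⟨b', hb'⟩ := cauchySeq_tendsto_of_complete cb
  obtain ⟨c, hc⟩ := cauchySeq_tendsto_of_complete cs
  refine ⟨c, b', hPc.mem_of_tendsto hb' (Eventually.of_forall hbP), ?_⟩
  have hκc : Continuous κ := aux_cont κ
  have h1 : Tendsto (fun n => q n (s n)) atTop (𝓝 (κ c + algebraMap ℝ B 0)) := by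
    refine ((hκc.tendsto c).comp hc).add ?_
    exact ((algebraMapCLM ℝ B).continuous.tendsto 0).comp
      (tendsto_pow_atTop_nhds_zero_of_lt_one (by norm_num) (by norm_num))
  have h2 := h1.mul hb'
  simp only [hab, map_zero, add_zero] at h2
  exact tendsto_nhds_unique tendsto_const_nhds h2

end aux

section aux2
open Filter Topology

variable {A C : Type*} [NonUnitalCStarAlgebra A] [NonUnitalCStarAlgebra C]

lemma aux_mul_coe (m : 𝓜(ℂ, A)) (a : A) : m * (a : 𝓜(ℂ, A)) = ((m.fst a : A) : 𝓜(ℂ, A)) := by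
  have hz : ∀ x : 𝓜(ℂ, A), x.fst = 0 → x = 0 := fun x hx => by
    rw [← norm_eq_zero, ← DoubleCentralizer.norm_fst, hx, norm_zero]
  apply eq_of_sub_eq_zero
  apply hz
  ext y
  have key : m.fst (a * y) = m.fst a * y := by
    have : ∀ z : A, z * (m.fst (a * y) - m.fst a * y) = 0 := by
      intro z
      rw [mul_sub, ← m.central, ← mul_assoc, ← mul_assoc, ← m.central, sub_self]
    have h := this (star (m.fst (a * y) - m.fst a * y))
    rw [CStarRing.star_mul_self_eq_zero_iff] at h
    exact sub_eq_zero.1 h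
  simp [DoubleCentralizer.sub_fst, key]

lemma aux_coe_mul (m : 𝓜(ℂ, A)) (a : A) : (a : 𝓜(ℂ, A)) * m = ((m.snd a : A) : 𝓜(ℂ, A)) := by
  have hz : ∀ x : 𝓜(ℂ, A), x.fst = 0 → x = 0 := fun x hx => by
    rw [← norm_eq_zero, ← DoubleCentralizer.norm_fst, hx, norm_zero]
  apply eq_of_sub_eq_zero
  apply hz
  ext y
  simp [DoubleCentralizer.sub_fst, m.central]

lemma aux_isometry : Isometry ((↑) : A → 𝓜(ℂ, A)) := by
  refine AddMonoidHomClass.isometry_of_norm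
    (DoubleCentralizer.coeHom (𝕜 := ℂ) (A := A)) (fun a => ?_)
  rw [← DoubleCentralizer.norm_fst]
  exact ContinuousLinearMap.opNorm_mul_apply ℂ A a

lemma aux_closed : IsClosed (Set.range ((↑) : A → 𝓜(ℂ, A))) :=
  aux_isometry.isClosedEmbedding.isClosed_range

lemma aux_ext (x y : 𝓜(ℂ, A)) (h : ∀ a : A, x * (a : 𝓜(ℂ, A)) = y * (a : 𝓜(ℂ, A))) : x = y := by
  apply eq_of_sub_eq_zero
  rw [← norm_eq_zero, ← DoubleCentralizer.norm_fst, norm_eq_zero]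
  ext a
  have := h a
  rw [aux_mul_coe, aux_mul_coe] at this
  simp [DoubleCentralizer.sub_fst, aux_isometry.injective this]

lemma aux_ext' (x y : 𝓜(ℂ, A)) (h : ∀ a : A, (a : 𝓜(ℂ, A)) * x = (a : 𝓜(ℂ, A)) * y) : x = y := by
  apply eq_of_sub_eq_zero
  rw [← norm_eq_zero, ← DoubleCentralizer.norm_snd, norm_eq_zero]
  ext a
  have := h a
  rw [aux_coe_mul, aux_coe_mul] at this
  simp [DoubleCentralizer.sub_snd, aux_isometry.injective this]

/-- Approximate unit of `C`, order-free, with its action through `κ`. -/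
lemma aux_approx [PartialOrder C] [StarOrderedRing C] (κ : C →⋆ₙₐ[ℂ] 𝓜(ℂ, A))
    (hnd : ∀ a : A, (a : 𝓜(ℂ, A)) ∈ closure
      (Submodule.span ℂ {x : 𝓜(ℂ, A) | ∃ (c : C) (b : A), x = κ c * (b : 𝓜(ℂ, A))} :
        Set 𝓜(ℂ, A))) (a : A) :
    Tendsto (fun e : C => κ e * (a : 𝓜(ℂ, A))) (CStarAlgebra.approximateUnit C)
      (𝓝 (a : 𝓜(ℂ, A))) := by
  have hl := CStarAlgebra.increasingApproximateUnit C
  have hκc : Continuous κ := aux_cont κ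
  have hspan : ∀ x ∈ Submodule.span ℂ {x : 𝓜(ℂ, A) | ∃ (c : C) (b : A), x = κ c * (b : 𝓜(ℂ, A))},
      Tendsto (fun e : C => κ e * x) (CStarAlgebra.approximateUnit C) (𝓝 x) := by
    intro x hx
    induction hx using Submodule.span_induction with
    | mem x hx =>
      obtain ⟨c, b, rfl⟩ := hx
      have := ((hκc.tendsto c).comp (hl.tendsto_mul_right c)).mul_const (b : 𝓜(ℂ, A))
      refine this.congr (fun e => ?_)
      simp [mul_assoc]
    | zero => simp
    | add x y _ _ hx hy => simpa [mul_add] using hx.add hy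
    | smul r x _ hx => simpa using hx.const_smul r
  rw [Metric.tendsto_nhds]
  intro ε hε
  obtain ⟨x, hx, hxa⟩ := Metric.mem_closure_iff.1 (hnd a) (ε/3) (by positivity)
  filter_upwards [Metric.tendsto_nhds.1 (hspan x hx) (ε/3) (by positivity), hl.eventually_norm]
    with e he hn
  have hn' : ‖κ e‖ ≤ 1 := (NonUnitalStarAlgHom.norm_apply_le κ e).trans hn
  rw [dist_eq_norm] at *
  have h1 : ‖κ e * ((a : 𝓜(ℂ, A)) - x)‖ ≤ ‖(a : 𝓜(ℂ, A)) - x‖ :=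
    (norm_mul_le _ _).trans (mul_le_of_le_one_left (norm_nonneg _) hn')
  have h2 : κ e * (a : 𝓜(ℂ, A)) - (a : 𝓜(ℂ, A)) =
      κ e * ((a : 𝓜(ℂ, A)) - x) + (κ e * x - x) - ((a : 𝓜(ℂ, A)) - x) := by
    rw [mul_sub]; abel
  rw [h2]
  have h3 := norm_sub_le (κ e * ((a : 𝓜(ℂ, A)) - x) + (κ e * x - x)) ((a : 𝓜(ℂ, A)) - x)
  have h4 := norm_add_le (κ e * ((a : 𝓜(ℂ, A)) - x)) (κ e * x - x)
  linarith

lemma aux_factor (κ : C →⋆ₙₐ[ℂ] 𝓜(ℂ, A))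
    (hnd : ∀ a : A, (a : 𝓜(ℂ, A)) ∈ closure
      (Submodule.span ℂ {x : 𝓜(ℂ, A) | ∃ (c : C) (b : A), x = κ c * (b : 𝓜(ℂ, A))} :
        Set 𝓜(ℂ, A))) (a : A) :
    ∃ (c : C) (b : A), (a : 𝓜(ℂ, A)) = κ c * (b : 𝓜(ℂ, A)) := by
  letI : PartialOrder C := CStarAlgebra.spectralOrder C
  haveI : StarOrderedRing C := CStarAlgebra.spectralOrderedRing C
  letI : PartialOrder 𝓜(ℂ, A) := CStarAlgebra.spectralOrder _
  haveI : StarOrderedRing 𝓜(ℂ, A) := CStarAlgebra.spectralOrderedRing _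
  have hl := CStarAlgebra.increasingApproximateUnit C
  obtain ⟨c, b, ⟨b, rfl⟩, h⟩ := aux_cohen κ (Set.range ((↑) : A → 𝓜(ℂ, A))) aux_closed
    (by rintro x _ ⟨b, rfl⟩; exact ⟨_, (aux_mul_coe x b).symm⟩)
    (by
      rintro _ ⟨b, rfl⟩ ε hε
      obtain ⟨e, h1, h2, h3⟩ := (hl.eventually_nonneg.and (hl.eventually_norm.and
        (Metric.tendsto_nhds.1 (aux_approx κ hnd b) ε hε))).exists
      refine ⟨e, h1, h2, ?_⟩
      rw [← dist_eq_norm, dist_comm]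
      exact h3.le) (a : 𝓜(ℂ, A)) ⟨a, rfl⟩
  exact ⟨c, b, h⟩

lemma aux_factor' (κ : C →⋆ₙₐ[ℂ] 𝓜(ℂ, A))
    (hnd : ∀ a : A, (a : 𝓜(ℂ, A)) ∈ closure
      (Submodule.span ℂ {x : 𝓜(ℂ, A) | ∃ (c : C) (b : A), x = κ c * (b : 𝓜(ℂ, A))} :
        Set 𝓜(ℂ, A))) (a : A) :
    ∃ (c : C) (b : A), (a : 𝓜(ℂ, A)) = (b : 𝓜(ℂ, A)) * κ c := by
  obtain ⟨c, b, h⟩ := aux_factor κ hnd (star a)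
  refine ⟨star c, star b, ?_⟩
  have hst : ∀ x : A, ((star x : A) : 𝓜(ℂ, A)) = star (x : 𝓜(ℂ, A)) :=
    fun x => map_star (DoubleCentralizer.coeHom (𝕜 := ℂ) (A := A)) x
  rw [hst, map_star, ← star_mul, ← h, hst, star_star]

lemma aux_uc_left (κ : C →⋆ₙₐ[ℂ] 𝓜(ℂ, A)) (c : C) :
    @UniformContinuous _ _ (cStrictUniformity κ) _ (fun m : 𝓜(ℂ, A) => κ c * m) := by
  rw [_root_.uniformContinuous_iff]
  exact iInf_le_of_le c inf_le_left

lemma aux_uc_right (κ : C →⋆ₙₐ[ℂ] 𝓜(ℂ, A)) (c : C) :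
    @UniformContinuous _ _ (cStrictUniformity κ) _ (fun m : 𝓜(ℂ, A) => m * κ c) := by
  rw [_root_.uniformContinuous_iff]
  exact iInf_le_of_le c inf_le_right

lemma aux_le (κ : C →⋆ₙₐ[ℂ] 𝓜(ℂ, A))
    (hnd : ∀ a : A, (a : 𝓜(ℂ, A)) ∈ closure
      (Submodule.span ℂ {x : 𝓜(ℂ, A) | ∃ (c : C) (b : A), x = κ c * (b : 𝓜(ℂ, A))} :
        Set 𝓜(ℂ, A))) : cStrictUniformity κ ≤ strictUniformity A := by
  refine le_iInf fun a => le_inf ?_ ?_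
  · obtain ⟨c, b, h⟩ := aux_factor' κ hnd a
    have h1 : UniformContinuous (fun m : 𝓜(ℂ, A) => (b : 𝓜(ℂ, A)) * m) :=
      (ContinuousLinearMap.mul ℂ 𝓜(ℂ, A) (b : 𝓜(ℂ, A))).uniformContinuous
    rw [← _root_.uniformContinuous_iff]
    have h2 := @UniformContinuous.comp _ _ _ (cStrictUniformity κ) _ _ _ _ h1 (aux_uc_left κ c)
    have h3 : (fun m : 𝓜(ℂ, A) => (a : 𝓜(ℂ, A)) * m) =
      (fun m : 𝓜(ℂ, A) => (b : 𝓜(ℂ, A)) * m) ∘ (fun m : 𝓜(ℂ, A) => κ c * m) := by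
      funext m; simp [h, mul_assoc]
    rw [h3]; exact h2
  · obtain ⟨c, b, h⟩ := aux_factor κ hnd a
    have h1 : UniformContinuous (fun m : 𝓜(ℂ, A) => m * (b : 𝓜(ℂ, A))) :=
      ((ContinuousLinearMap.mul ℂ 𝓜(ℂ, A)).flip (b : 𝓜(ℂ, A))).uniformContinuous
    rw [← _root_.uniformContinuous_iff]
    have h2 := @UniformContinuous.comp _ _ _ (cStrictUniformity κ) _ _ _ _ h1 (aux_uc_right κ c)
    have h3 : (fun m : 𝓜(ℂ, A) => m * (a : 𝓜(ℂ, A))) =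
      (fun m : 𝓜(ℂ, A) => m * (b : 𝓜(ℂ, A))) ∘ (fun m : 𝓜(ℂ, A) => m * κ c) := by
      funext m; simp [h, mul_assoc]
    rw [h3]; exact h2

lemma aux_inf {X : Type*} (u v : UniformSpace X) (f : Filter X) (x : X)
    (hu : f ≤ @nhds _ u.toTopologicalSpace x) (hv : f ≤ @nhds _ v.toTopologicalSpace x) :
    f ≤ @nhds _ (u ⊓ v).toTopologicalSpace x := by
  have h : f ≤ @nhds _ (u.toTopologicalSpace ⊓ v.toTopologicalSpace) x := by
    exact (le_inf hu hv).trans_eq (@nhds_inf X u.toTopologicalSpace v.toTopologicalSpace x).symm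
  exact h

lemma aux_le_nhds (κ : C →⋆ₙₐ[ℂ] 𝓜(ℂ, A)) (f : Filter 𝓜(ℂ, A)) (m : 𝓜(ℂ, A))
    (h1 : ∀ c, Tendsto (fun x => κ c * x) f (𝓝 (κ c * m)))
    (h2 : ∀ c, Tendsto (fun x => x * κ c) f (𝓝 (m * κ c))) :
    f ≤ @nhds _ (cStrictUniformity κ).toTopologicalSpace m := by
  unfold cStrictUniformity
  rw [UniformSpace.toTopologicalSpace_iInf, nhds_iInf]
  refine le_iInf fun c => ?_
  refine aux_inf _ _ _ _ ?_ ?_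
  · rw [UniformSpace.toTopologicalSpace_comap, nhds_induced]
    exact tendsto_iff_comap.1 (h1 c)
  · rw [UniformSpace.toTopologicalSpace_comap, nhds_induced]
    exact tendsto_iff_comap.1 (h2 c)

lemma aux_dense (κ : C →⋆ₙₐ[ℂ] 𝓜(ℂ, A))
    (hnd : ∀ a : A, (a : 𝓜(ℂ, A)) ∈ closure
      (Submodule.span ℂ {x : 𝓜(ℂ, A) | ∃ (c : C) (b : A), x = κ c * (b : 𝓜(ℂ, A))} :
        Set 𝓜(ℂ, A))) (m : 𝓜(ℂ, A)) (hm : m ∈ MCset κ) :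
    m ∈ @closure _ (cStrictUniformity κ).toTopologicalSpace
        (Set.range ((↑) : A → 𝓜(ℂ, A))) := by
  letI : PartialOrder C := CStarAlgebra.spectralOrder C
  haveI : StarOrderedRing C := CStarAlgebra.spectralOrderedRing C
  have hl := CStarAlgebra.increasingApproximateUnit C
  have hκc : Continuous κ := aux_cont κ
  have := hl.neBot
  have key : Tendsto (fun e : C => κ e * m) (CStarAlgebra.approximateUnit C)
      (@nhds _ (cStrictUniformity κ).toTopologicalSpace m) := by
    refine aux_le_nhds κ _ m (fun c => ?_) (fun c => ?_)
    · rw [tendsto_map'_iff]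
      refine (((hκc.tendsto c).comp (hl.tendsto_mul_left c)).mul_const m).congr (fun e => ?_)
      simp [mul_assoc]
    · rw [tendsto_map'_iff]
      obtain ⟨a, ha⟩ := (hm c).2
      rw [ha]
      refine (aux_approx κ hnd a).congr (fun e => ?_)
      simp [← ha, mul_assoc]
  refine @mem_closure_of_tendsto _ (cStrictUniformity κ).toTopologicalSpace _ _ _ _ _ _ key
    (Eventually.of_forall fun e => ?_)
  obtain ⟨a, ha⟩ := (hm e).1
  exact ⟨a, ha.symm⟩

lemma aux_complete (κ : C →⋆ₙₐ[ℂ] 𝓜(ℂ, A))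
    (hnd : ∀ a : A, (a : 𝓜(ℂ, A)) ∈ closure
      (Submodule.span ℂ {x : 𝓜(ℂ, A) | ∃ (c : C) (b : A), x = κ c * (b : 𝓜(ℂ, A))} :
        Set 𝓜(ℂ, A))) :
    @IsComplete 𝓜(ℂ, A) (cStrictUniformity κ) (MCset κ) := by
  intro f hf hfs
  have hne : f.NeBot := hf.1
  have hle := aux_le κ hnd
  -- norm limits against `A`
  have hL : ∀ a : A, ∃ y : A, Tendsto (fun m : 𝓜(ℂ, A) => m.fst a) f (𝓝 y) := by
    intro a
    have huc : @UniformContinuous _ _ (cStrictUniformity κ) _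
        (fun m : 𝓜(ℂ, A) => m * (a : 𝓜(ℂ, A))) := by
      rw [_root_.uniformContinuous_iff]
      exact hle.trans (iInf_le_of_le a inf_le_right)
    have h1 := @Cauchy.map _ _ (cStrictUniformity κ) _ _ _ hf huc
    have h2 : Cauchy (map (fun m : 𝓜(ℂ, A) => m.fst a) f) := by
      refine aux_isometry.isUniformInducing.cauchy_map_iff.1 ?_
      rw [map_map]
      have h3 := funext fun m : 𝓜(ℂ, A) => aux_mul_coe m a
      rw [h3] at h1
      exact h1
    exact CompleteSpace.complete h2
  have hR : ∀ a : A, ∃ y : A, Tendsto (fun m : 𝓜(ℂ, A) => m.snd a) f (𝓝 y) := by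
    intro a
    have huc : @UniformContinuous _ _ (cStrictUniformity κ) _
        (fun m : 𝓜(ℂ, A) => (a : 𝓜(ℂ, A)) * m) := by
      rw [_root_.uniformContinuous_iff]
      exact hle.trans (iInf_le_of_le a inf_le_left)
    have h1 := @Cauchy.map _ _ (cStrictUniformity κ) _ _ _ hf huc
    have h2 : Cauchy (map (fun m : 𝓜(ℂ, A) => m.snd a) f) := by
      refine aux_isometry.isUniformInducing.cauchy_map_iff.1 ?_
      rw [map_map]
      have h3 := funext fun m : 𝓜(ℂ, A) => aux_coe_mul m a
      rw [h3] at h1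
      exact h1
    exact CompleteSpace.complete h2
  choose L hL using hL
  choose R hR using hR
  have hcen : ∀ x y, R x * y = x * L y := by
    intro x y
    refine tendsto_nhds_unique ((hR x).mul_const y) (((hL y).const_mul x).congr fun m => ?_)
    exact (m.central x y).symm
  let Ll : A →ₗ[ℂ] A :=
    { toFun := L
      map_add' := fun x y => tendsto_nhds_unique (hL (x + y))
        (((hL x).add (hL y)).congr fun m => (map_add _ _ _).symm)
      map_smul' := fun r x => tendsto_nhds_unique (hL (r • x))
        (((hL x).const_smul r).congr fun m => (map_smul _ _ _).symm) }
  let Rl : A →ₗ[ℂ] A :=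
    { toFun := R
      map_add' := fun x y => tendsto_nhds_unique (hR (x + y))
        (((hR x).add (hR y)).congr fun m => (map_add _ _ _).symm)
      map_smul' := fun r x => tendsto_nhds_unique (hR (r • x))
        (((hR x).const_smul r).congr fun m => (map_smul _ _ _).symm) }
  have hLc : Continuous Ll := by
    refine Ll.continuous_of_seq_closed_graph fun u x y hu hy => ?_
    have h : ∀ z, z * (y - L x) = 0 := by
      intro z
      have h1 : Tendsto (fun n => z * L (u n)) atTop (𝓝 (z * y)) := hy.const_mul z
      have h2 : Tendsto (fun n => z * L (u n)) atTop (𝓝 (z * L x)) := by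
        simp only [← hcen]
        exact hu.const_mul _
      rw [mul_sub, tendsto_nhds_unique h1 h2, sub_self]
    exact sub_eq_zero.1 ((CStarRing.star_mul_self_eq_zero_iff _).1 (h (star (y - L x))))
  have hRc : Continuous Rl := by
    refine Rl.continuous_of_seq_closed_graph fun u x y hu hy => ?_
    have h : ∀ z, (y - R x) * z = 0 := by
      intro z
      have h1 : Tendsto (fun n => R (u n) * z) atTop (𝓝 (y * z)) := hy.mul_const z
      have h2 : Tendsto (fun n => R (u n) * z) atTop (𝓝 (R x * z)) := by
        simp only [hcen]
        exact hu.mul_const _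
      rw [sub_mul, tendsto_nhds_unique h1 h2, sub_self]
    exact sub_eq_zero.1 ((CStarRing.mul_star_self_eq_zero_iff _).1 (h (star (y - R x))))
  let M : 𝓜(ℂ, A) := ⟨(⟨Ll, hLc⟩, ⟨Rl, hRc⟩), hcen⟩
  have hML : ∀ a : A, Tendsto (fun m : 𝓜(ℂ, A) => m * (a : 𝓜(ℂ, A))) f
      (𝓝 (M * (a : 𝓜(ℂ, A)))) := by
    intro a
    simp only [aux_mul_coe]
    exact (aux_isometry.continuous.tendsto _).comp (hL a)
  have hMR : ∀ a : A, Tendsto (fun m : 𝓜(ℂ, A) => (a : 𝓜(ℂ, A)) * m) f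
      (𝓝 ((a : 𝓜(ℂ, A)) * M)) := by
    intro a
    simp only [aux_coe_mul]
    exact (aux_isometry.continuous.tendsto _).comp (hR a)
  have h1 : ∀ c, Tendsto (fun x => κ c * x) f (𝓝 (κ c * M)) := by
    intro c
    obtain ⟨x, hx⟩ := CompleteSpace.complete
      (@Cauchy.map _ _ (cStrictUniformity κ) _ _ _ hf (aux_uc_left κ c))
    have hx' : Tendsto (fun m => κ c * m) f (𝓝 x) := hx
    have : x = κ c * M := aux_ext _ _ fun a => by
      refine tendsto_nhds_unique (hx'.mul_const (a : 𝓜(ℂ, A))) ?_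
      simp only [mul_assoc]
      exact (hML a).const_mul _
    rwa [this] at hx'
  have h2 : ∀ c, Tendsto (fun x => x * κ c) f (𝓝 (M * κ c)) := by
    intro c
    obtain ⟨x, hx⟩ := CompleteSpace.complete
      (@Cauchy.map _ _ (cStrictUniformity κ) _ _ _ hf (aux_uc_right κ c))
    have hx' : Tendsto (fun m => m * κ c) f (𝓝 x) := hx
    have : x = M * κ c := aux_ext' _ _ fun a => by
      refine tendsto_nhds_unique (hx'.const_mul (a : 𝓜(ℂ, A))) ?_
      simp only [← mul_assoc]
      exact (hMR a).mul_const _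
    rwa [this] at hx'
  have hev : ∀ᶠ m in f, m ∈ MCset κ := hfs (mem_principal_self _)
  refine ⟨M, fun c => ⟨?_, ?_⟩, aux_le_nhds κ f M h1 h2⟩
  · obtain ⟨a, ha⟩ := aux_closed.mem_of_tendsto (h1 c) (hev.mono fun m hm => by
      obtain ⟨a, ha⟩ := (hm c).1
      exact ⟨a, ha.symm⟩)
    exact ⟨a, ha.symm⟩
  · obtain ⟨a, ha⟩ := aux_closed.mem_of_tendsto (h2 c) (hev.mono fun m hm => by
      obtain ⟨a, ha⟩ := (hm c).2
      exact ⟨a, ha.symm⟩)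
    exact ⟨a, ha.symm⟩

end aux2

/-- For a nondegenerate `κ : C → M(A)`: (1) on `M_C(A)` the `C`-strict
topology is finer than the relative strict topology from `M(A)`; (2) `A` is `C`-strictly
dense in `M_C(A)`; (3) `M_C(A)` is `C`-strictly complete. -/
theorem stmt14 {A C : Type*} [NonUnitalCStarAlgebra A] [NonUnitalCStarAlgebra C]
    (κ : C →⋆ₙₐ[ℂ] 𝓜(ℂ, A))
    (hnd : ∀ a : A, (a : 𝓜(ℂ, A)) ∈ closure
      (Submodule.span ℂ {x : 𝓜(ℂ, A) | ∃ (c : C) (b : A), x = κ c * (b : 𝓜(ℂ, A))} :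
        Set 𝓜(ℂ, A))) :
    (TopologicalSpace.induced ((Subtype.val) : MCset κ → 𝓜(ℂ, A))
        (cStrictUniformity κ).toTopologicalSpace ≤
      TopologicalSpace.induced ((Subtype.val) : MCset κ → 𝓜(ℂ, A))
        (strictUniformity A).toTopologicalSpace) ∧
    (∀ m ∈ MCset κ, m ∈ @closure _ (cStrictUniformity κ).toTopologicalSpace
        (Set.range ((↑) : A → 𝓜(ℂ, A)))) ∧
    @IsComplete 𝓜(ℂ, A) (cStrictUniformity κ) (MCset κ) := by
  exact ⟨induced_mono (UniformSpace.toTopologicalSpace_mono (aux_le κ hnd)),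
    fun m hm => aux_dense κ hnd m hm, aux_complete κ hnd⟩
end

section
/- Let $A, B, C, D$ be C*-algebras, and let $\kappa : C \to M(A)$, $\sigma : D \to M(B)$, $\lambda : C \to M(\sigma(D))$ be nondegenerate homomorphisms, and $\pi : A \to M_D(B)$ a homomorphism such that $\pi(\kappa(c)a) = \lambda(c)\pi(a)$ for all $c \in C$, $a \in A$. Then $\pi$ extends uniquely to a $C$-strict to $D$-strictly continuous homomorphism $\bar\pi : M_C(A) \to M_D(B)$; moreover $\bar\pi(\bar\kappa(n)m) = \bar\lambda(n)\bar\pi(m)$ and $\bar\pi(m\bar\kappa(n)) = \bar\pi(m)\bar\lambda(n)$ for all $n \in M(C)$, $m \in M_C(A)$. -/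
open scoped MultiplierAlgebra

section AuxLemmas
open Filter Topology
open scoped MultiplierAlgebra

lemma aux_tendsto_zero {ι V W : Type*} [NormedAddCommGroup V] [NormedSpace ℂ V]
    [NormedAddCommGroup W] [NormedSpace ℂ W]
    {l : Filter ι} (T : ι → V →L[ℂ] W) {K : ℝ} (hT : ∀ᶠ i in l, ‖T i‖ ≤ K) (X : Set V)
    (hX : ∀ x ∈ X, Tendsto (fun i => T i x) l (𝓝 0)) {y : V}
    (hy : y ∈ closure (Submodule.span ℂ X : Set V)) : Tendsto (fun i => T i y) l (𝓝 0) := by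
  have hspan : ∀ x ∈ Submodule.span ℂ X, Tendsto (fun i => T i x) l (𝓝 0) := by
    intro x hx
    induction hx using Submodule.span_induction with
    | mem x h => exact hX x h
    | zero => simpa using tendsto_const_nhds
    | add x y _ _ h1 h2 => simpa using h1.add h2
    | smul a x _ h => simpa using h.const_smul a
  rw [Metric.tendsto_nhds]
  intro ε hε
  obtain ⟨x, hx, hxy⟩ := Metric.mem_closure_iff.1 hy (ε / (2 * (|K| + 1))) (by positivity)
  filter_upwards [hT, Metric.tendsto_nhds.1 (hspan x hx) (ε / 2) (by positivity)] with i h1 h2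
  rw [dist_zero_right] at h2 ⊢
  have h3 : T i y = T i (y - x) + T i x := by simp
  rw [dist_eq_norm] at hxy
  have hK : K ≤ |K| + 1 := (le_abs_self K).trans (by linarith)
  calc ‖T i y‖ ≤ ‖T i (y - x)‖ + ‖T i x‖ := by rw [h3]; exact norm_add_le _ _
    _ < (|K| + 1) * (ε / (2 * (|K| + 1))) + ε / 2 := by
      refine add_lt_add_of_le_of_lt ?_ h2
      refine ((T i).le_opNorm _).trans ?_
      exact mul_le_mul (h1.trans hK) hxy.le (norm_nonneg _) (by positivity)
    _ = ε := by field_simp; norm_num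

lemma aux_inv_s15 {M : Type*} [NormedRing M] [NormedAlgebra ℂ M] [CompleteSpace M]
    (S : Submodule ℂ M) (hS : IsClosed (S : Set M)) (T : M) (hT : ‖T‖ < 1)
    (hST : ∀ z ∈ S, z * T ∈ S) (y : M) (hy : y ∈ S) : ∃ z ∈ S, z * (1 - T) = y := by
  have hs := summable_geometric_of_norm_lt_one hT
  refine ⟨y * ∑' i : ℕ, T ^ i, ?_, by rw [mul_assoc, geom_series_mul_neg T hT, mul_one]⟩
  have h := (hs.hasSum.mul_left y).tendsto_sum_nat
  refine hS.mem_of_tendsto h (Eventually.of_forall fun n => ?_)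
  refine S.sum_mem fun i hi => ?_
  clear hi
  induction i with
  | zero => simpa using hy
  | succ i ih => rw [pow_succ, ← mul_assoc]; exact hST _ ih

lemma aux_inv_norm {M : Type*} [NormedRing M] {T v z : M} {r : ℝ} (hr : 0 < r)
    (hT : ‖T‖ ≤ 1 - r) (h : v * (1 - T) = z) : ‖v‖ ≤ r⁻¹ * ‖z‖ := by
  have h1 : v = z + v * T := by rw [← h]; noncomm_ring
  have h2 : ‖v‖ ≤ ‖z‖ + ‖v‖ * (1 - r) := by
    calc ‖v‖ = ‖z + v * T‖ := by rw [← h1]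
      _ ≤ ‖z‖ + ‖v * T‖ := norm_add_le _ _
      _ ≤ ‖z‖ + ‖v‖ * ‖T‖ := by gcongr; exact norm_mul_le _ _
      _ ≤ _ := by gcongr
  rw [le_inv_mul_iff₀ hr]; linarith

lemma aux_cohen_s15 {M C : Type*} [NormedRing M] [NormedAlgebra ℂ M] [CompleteSpace M]
    [NormedAddCommGroup C] [NormedSpace ℂ C] [CompleteSpace C] (φ : C →L[ℂ] M)
    (S : Submodule ℂ M) (hS : IsClosed (S : Set M)) (hSφ : ∀ z ∈ S, ∀ c, z * φ c ∈ S)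
    (happ : ∀ z ∈ S, ∀ ε > 0, ∃ e : C, ‖e‖ ≤ 1 ∧ ‖1 - φ e‖ ≤ 1 ∧ ‖z - z * φ e‖ < ε)
    (y : M) (hy : y ∈ S) : ∃ x c, y = x * φ c := by
  let P : ℕ → C × M → Prop := fun n p =>
    ‖1 - (φ p.1 + ((1/2 : ℂ)^n) • (1 : M))‖ ≤ 1 - (1/2 : ℝ)^n ∧ p.2 ∈ S ∧
      p.2 * (φ p.1 + ((1/2 : ℂ)^n) • (1 : M)) = y
  have step : ∀ n p, ∃ q, P n p → (P (n+1) q ∧ ‖p.1 - q.1‖ ≤ 1 * (1/2 : ℝ)^n ∧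
      ‖p.2 - q.2‖ ≤ 1 * (1/2 : ℝ)^n) := by
    intro n p
    by_cases hp : P n p
    swap
    · exact ⟨p, fun h => absurd h hp⟩
    obtain ⟨h1, h2, h3⟩ := hp
    obtain ⟨e, he1, he2, he3⟩ := happ p.2 h2 ((1/2 : ℝ)^n) (by positivity)
    have hnorm : ‖(1/2 : ℂ)^(n+1)‖ = (1/2 : ℝ)^(n+1) := by simp
    have hhalf : (1/2 : ℂ)^n = (1/2 : ℂ)^(n+1) + (1/2 : ℂ)^(n+1) := by ring
    set t : ℂ := (1/2 : ℂ)^(n+1) with ht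
    set c' := p.1 + t • e with hc'
    set W := φ c' + t • (1 : M) with hW
    have hWW : W = (φ p.1 + ((1/2 : ℂ)^n) • (1 : M)) - t • (1 - φ e) := by
      rw [hW, hc', hhalf, map_add, map_smul, smul_sub, add_smul]; abel
    have hTn : ‖1 - W‖ ≤ 1 - (1/2 : ℝ)^(n+1) := by
      have : 1 - W = (1 - (φ p.1 + ((1/2 : ℂ)^n) • (1 : M))) + t • (1 - φ e) := by
        rw [hWW]; abel
      rw [this]
      refine (norm_add_le _ _).trans ?_
      rw [norm_smul, hnorm]
      have : (1/2 : ℝ)^(n+1) * ‖1 - φ e‖ ≤ (1/2 : ℝ)^(n+1) * 1 := by gcongr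
      have h5 : (1/2 : ℝ)^n = (1/2 : ℝ)^(n+1) + (1/2 : ℝ)^(n+1) := by ring
      linarith
    have hpos : (0:ℝ) < (1/2 : ℝ)^(n+1) := by positivity
    obtain ⟨z, hz, hzy⟩ := aux_inv_s15 S hS (1 - W) (by linarith) (by
      intro z hz
      rw [mul_sub, hW, mul_add, mul_one, mul_smul_comm, mul_one]
      exact S.sub_mem hz (S.add_mem (hSφ z hz _) (S.smul_mem _ hz))) y hy
    refine ⟨(c', z), fun _ => ⟨⟨hTn, hz, ?_⟩, ?_, ?_⟩⟩
    · rw [sub_sub_cancel] at hzy; exact hzy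
    · simp only [hc', sub_add_cancel_left, norm_neg, norm_smul, hnorm]
      have : (1/2 : ℝ)^(n+1) * ‖e‖ ≤ (1/2 : ℝ)^(n+1) * 1 := by gcongr
      have h5 : (1/2 : ℝ)^n = (1/2 : ℝ)^(n+1) + (1/2 : ℝ)^(n+1) := by ring
      linarith
    · have h6 : (p.2 - z) * (1 - (1 - W)) = - (t • (p.2 - p.2 * φ e)) := by
        rw [sub_mul, hzy, ← h3, sub_sub_cancel, hWW, mul_sub, mul_smul_comm, mul_sub, mul_one]
        abel
      have := aux_inv_norm hpos hTn h6
      rw [norm_neg, norm_smul, hnorm, inv_mul_cancel_left₀ hpos.ne'] at this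
      simpa using this.trans he3.le
  choose F hF using step
  let s : ℕ → C × M := fun n => Nat.rec (0, y) F n
  have hs : ∀ n, P n (s n) := by
    intro n
    induction n with
    | zero => exact ⟨by simp [s], hy, by simp [s]⟩
    | succ n ih => exact (hF n (s n) ih).1
  have c1 : CauchySeq (fun n => (s n).1) :=
    cauchySeq_of_le_geometric (1/2) 1 (by norm_num) fun n => by
      rw [dist_eq_norm]; exact (hF n (s n) (hs n)).2.1
  have c2 : CauchySeq (fun n => (s n).2) :=
    cauchySeq_of_le_geometric (1/2) 1 (by norm_num) fun n => by
      rw [dist_eq_norm]; exact (hF n (s n) (hs n)).2.2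
  obtain ⟨c, hc⟩ := cauchySeq_tendsto_of_complete c1
  obtain ⟨x, hx⟩ := cauchySeq_tendsto_of_complete c2
  refine ⟨x, c, ?_⟩
  have h0 : Tendsto (fun n : ℕ => ((1/2 : ℂ)^n) • (1 : M)) atTop (𝓝 ((0:ℂ) • 1)) :=
    (tendsto_pow_atTop_nhds_zero_of_norm_lt_one (by norm_num)).smul_const _
  have h1 := hx.mul (((φ.continuous.tendsto c).comp hc).add h0)
  have h2 : Tendsto (fun n : ℕ => y) atTop (𝓝 (x * (φ c + (0:ℂ) • 1))) :=
    h1.congr fun n => (hs n).2.2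
  simpa using tendsto_nhds_unique tendsto_const_nhds h2

/-- the canonical approximate unit -/
noncomputable def auF (C : Type*) [NonUnitalCStarAlgebra C] : Filter C :=
  let _ := CStarAlgebra.spectralOrder C
  have _ := CStarAlgebra.spectralOrderedRing C
  CStarAlgebra.approximateUnit C

lemma auF_spec (C : Type*) [NonUnitalCStarAlgebra C] :
    (auF C).IsApproximateUnit ∧ (∀ᶠ e in auF C, ‖e‖ ≤ 1 ∧ star e = e) := by
  let _ := CStarAlgebra.spectralOrder C
  have _ := CStarAlgebra.spectralOrderedRing C
  have h := CStarAlgebra.increasingApproximateUnit C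
  exact ⟨h.toIsApproximateUnit, h.eventually_norm.and h.eventually_star_eq⟩

instance auF_neBot (C : Type*) [NonUnitalCStarAlgebra C] : (auF C).NeBot := (auF_spec C).1.neBot

lemma auF_one_sub {C M : Type*} [NonUnitalCStarAlgebra C] [CStarAlgebra M] (φ : C →⋆ₙₐ[ℂ] M) :
    ∀ᶠ e in auF C, ‖1 - φ e‖ ≤ 1 := by
  let _ := CStarAlgebra.spectralOrder C
  have _ := CStarAlgebra.spectralOrderedRing C
  let _ := CStarAlgebra.spectralOrder M
  have _ := CStarAlgebra.spectralOrderedRing M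
  have h := CStarAlgebra.increasingApproximateUnit C
  have h2 : ∀ᶠ e in CStarAlgebra.approximateUnit C, ‖1 - φ e‖ ≤ 1 := by
    filter_upwards [h.eventually_nonneg, h.eventually_norm] with e h0 h1
    have h3 : 0 ≤ φ e := map_nonneg φ h0
    have h4 : ‖φ e‖ ≤ 1 := (NonUnitalStarAlgHom.norm_apply_le φ e).trans h1
    have h5 : φ e ≤ 1 := (CStarAlgebra.norm_le_one_iff_of_nonneg (φ e) h3).1 h4
    exact (CStarAlgebra.norm_le_one_iff_of_nonneg _ (sub_nonneg.2 h5)).2 (by simpa using h3)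
  exact h2

section
variable {C M : Type*} [NonUnitalCStarAlgebra C] [CStarAlgebra M] (φ : C →⋆ₙₐ[ℂ] M)

lemma aux_cont_s15 : Continuous φ :=
  AddMonoidHomClass.continuous_of_bound φ 1 fun x => by
    simpa using NonUnitalStarAlgHom.norm_apply_le φ x

lemma aux_au_left (X : Set M) (hX : ∀ x ∈ X, ∃ c z, x = φ c * z) {y : M}
    (hy : y ∈ closure (Submodule.span ℂ X : Set M)) :
    Tendsto (fun e => φ e * y) (auF C) (𝓝 y) := by
  have := aux_tendsto_zero (l := auF C) (fun e => ContinuousLinearMap.mul ℂ M (φ e - 1)) (K := 1)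
    ?_ X ?_ hy
  · have h := this.add_const y
    simpa [sub_mul] using h
  · filter_upwards [auF_one_sub φ] with e he
    refine (ContinuousLinearMap.opNorm_mul_apply_le ℂ M _).trans ?_
    rwa [norm_sub_rev]
  · intro x hx
    obtain ⟨c, z, rfl⟩ := hX x hx
    have h1 := ((((aux_cont_s15 φ).tendsto c).comp ((auF_spec C).1.tendsto_mul_right c)).mul_const
      z).sub_const (φ c * z)
    simpa [sub_mul, mul_assoc] using h1

lemma aux_au_star {y : M} (h : Tendsto (fun e => φ e * star y) (auF C) (𝓝 (star y))) :
    Tendsto (fun e => y * φ e) (auF C) (𝓝 y) := by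
  have := h.star
  rw [star_star] at this
  refine this.congr' ?_
  filter_upwards [(auF_spec C).2] with e he
  rw [star_mul, star_star, ← map_star, he.2]

lemma aux_fact_right {y : M} (hy : Tendsto (fun e => y * φ e) (auF C) (𝓝 y)) :
    ∃ x c, y = x * φ c := by
  let Q : Submodule ℂ M :=
    { carrier := {y | Tendsto (fun e => y * φ e) (auF C) (𝓝 y)}
      add_mem' := fun {a b} ha hb => by
        simpa [add_mul] using Tendsto.add ha hb
      zero_mem' := by simp
      smul_mem' := fun t a ha => by
        simpa using Tendsto.const_smul ha t }
  let Φ : C →L[ℂ] M := ⟨(φ : C →ₗ[ℂ] M), aux_cont_s15 φ⟩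
  refine aux_cohen_s15 Φ Q ?_ ?_ ?_ y hy
  · refine isClosed_of_closure_subset fun z hz => ?_
    have hz' : z ∈ closure (Submodule.span ℂ (Q : Set M) : Set M) := by simpa using hz
    have := aux_tendsto_zero (l := auF C)
      (fun e => (ContinuousLinearMap.mul ℂ M).flip (φ e - 1)) (K := 1) ?_ (Q : Set M) ?_ hz'
    · have h := this.add_const z
      change Tendsto (fun e => z * φ e) (auF C) (𝓝 z)
      simpa [mul_sub] using h
    · filter_upwards [auF_one_sub φ] with e he
      refine ContinuousLinearMap.opNorm_le_bound _ zero_le_one fun x => ?_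
      simp only [ContinuousLinearMap.flip_apply, ContinuousLinearMap.mul_apply', one_mul]
      refine (norm_mul_le _ _).trans ?_
      rw [norm_sub_rev]
      exact mul_le_of_le_one_right (norm_nonneg _) he
    · intro x hx
      have h1 := Tendsto.sub_const (show Tendsto (fun e => x * φ e) (auF C) (𝓝 x) from hx) x
      simpa [mul_sub] using h1
  · intro z _ c
    have h1 := (((aux_cont_s15 φ).tendsto c).comp ((auF_spec C).1.tendsto_mul_left c)).const_mul z
    change Tendsto (fun e => z * φ c * φ e) (auF C) (𝓝 (z * φ c))
    simpa [mul_assoc, Function.comp_def] using h1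
  · intro z hz ε hε
    have hz' : Tendsto (fun e => z * φ e) (auF C) (𝓝 z) := hz
    obtain ⟨e, h1, h2, h3⟩ := ((auF_spec C).2.and ((auF_one_sub φ).and
      (Metric.tendsto_nhds.1 hz' ε hε))).exists
    exact ⟨e, h1.1, h2, by rw [dist_comm, dist_eq_norm] at h3; exact h3⟩

lemma aux_fact_left {y : M} (hy : Tendsto (fun e => φ e * y) (auF C) (𝓝 y)) :
    ∃ x c, y = φ c * x := by
  obtain ⟨x, c, h⟩ := aux_fact_right φ (y := star y) (aux_au_star φ (by simpa using hy))
  exact ⟨star x, star c, by rw [map_star, ← star_mul, ← h, star_star]⟩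
end

section
variable {B : Type*} [NonUnitalCStarAlgebra B]

lemma mc_mul_coe (m : 𝓜(ℂ, B)) (b : B) : m * (b : 𝓜(ℂ, B)) = ((m.fst b : B) : 𝓜(ℂ, B)) := by
  refine DoubleCentralizer.ext _ _ _ _ (Prod.ext (ContinuousLinearMap.ext fun x => ?_)
    (ContinuousLinearMap.ext fun x => ?_))
  · change m.fst (b * x) = m.fst b * x
    have h : ∀ z : B, z * (m.fst (b * x) - m.fst b * x) = 0 := fun z => by
      rw [mul_sub, ← m.central, ← mul_assoc z, ← m.central, mul_assoc, sub_self]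
    have := h (star (m.fst (b * x) - m.fst b * x))
    rw [CStarRing.star_mul_self_eq_zero_iff] at this
    exact sub_eq_zero.1 this
  · change m.snd x * b = x * m.fst b
    exact m.central x b

lemma mc_coe_star (b : B) : star (b : 𝓜(ℂ, B)) = ((star b : B) : 𝓜(ℂ, B)) :=
  (map_star (DoubleCentralizer.coeHom (𝕜 := ℂ) (A := B)) b).symm

lemma mc_coe_mul (m : 𝓜(ℂ, B)) (b : B) : (b : 𝓜(ℂ, B)) * m = ((m.snd b : B) : 𝓜(ℂ, B)) := by
  have := congrArg star (mc_mul_coe (star m) (star b))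
  rw [star_mul, mc_coe_star, mc_coe_star, star_star, star_star] at this
  simpa using this

lemma mc_ext {x y : 𝓜(ℂ, B)} (h : ∀ b : B, x * (b : 𝓜(ℂ, B)) = y * (b : 𝓜(ℂ, B))) : x = y := by
  have hinj : Function.Injective (DoubleCentralizer.coeHom (𝕜 := ℂ) (A := B)) := by
    rw [injective_iff_map_eq_zero]
    intro a ha
    have h1 : (DoubleCentralizer.coeHom (𝕜 := ℂ) (A := B) a).fst (star a) = 0 := by
      rw [ha]; rfl
    exact (CStarRing.mul_star_self_eq_zero_iff a).1 h1
  have h2 : (x - y).fst = 0 := by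
    ext b
    have := h b
    rw [mc_mul_coe, mc_mul_coe] at this
    have := hinj this
    change x.fst b - y.fst b = 0
    rw [this, sub_self]
  have h3 : ‖x - y‖ = 0 := by rw [← DoubleCentralizer.norm_fst, h2, norm_zero]
  exact sub_eq_zero.1 (norm_eq_zero.1 h3)

lemma mc_coe_inj : Function.Injective (DoubleCentralizer.coeHom (𝕜 := ℂ) (A := B)) := by
  rw [injective_iff_map_eq_zero]
  intro a ha
  have h1 : (DoubleCentralizer.coeHom (𝕜 := ℂ) (A := B) a).fst (star a) = 0 := by
    rw [ha]; rfl
  exact (CStarRing.mul_star_self_eq_zero_iff a).1 h1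

lemma mc_isometry : Isometry (fun b : B => (b : 𝓜(ℂ, B))) :=
  NonUnitalStarAlgHom.isometry (DoubleCentralizer.coeHom (𝕜 := ℂ) (A := B)) mc_coe_inj

lemma mc_closed : IsClosed (Set.range (fun b : B => (b : 𝓜(ℂ, B)))) :=
  mc_isometry.isClosedEmbedding.isClosed_range

lemma mc_ext' {x y : 𝓜(ℂ, B)} (h : ∀ b : B, (b : 𝓜(ℂ, B)) * x = (b : 𝓜(ℂ, B)) * y) : x = y := by
  apply star_injective
  refine mc_ext fun b => ?_
  have := congrArg star (h (star b))
  rwa [star_mul, star_mul, mc_coe_star, star_star] at this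

lemma mc_limit {ι : Type*} {l : Filter ι} [l.NeBot] (u : ι → 𝓜(ℂ, B)) {K : ℝ}
    (hu : ∀ᶠ i in l, ‖u i‖ ≤ K)
    (h1 : ∀ b : B, ∃ z, Tendsto (fun i => u i * (b : 𝓜(ℂ, B))) l (𝓝 z))
    (h2 : ∀ b : B, ∃ z, Tendsto (fun i => (b : 𝓜(ℂ, B)) * u i) l (𝓝 z)) :
    ∃ F : 𝓜(ℂ, B), ∀ b : B, Tendsto (fun i => u i * (b : 𝓜(ℂ, B))) l (𝓝 (F * b)) ∧
      Tendsto (fun i => (b : 𝓜(ℂ, B)) * u i) l (𝓝 (b * F)) := by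
  have key : ∀ v : ι → B, (∃ z, Tendsto (fun i => (v i : 𝓜(ℂ, B))) l (𝓝 z)) →
      ∃ b : B, Tendsto v l (𝓝 b) := by
    rintro v ⟨z, hz⟩
    obtain ⟨b, rfl⟩ := mc_closed.mem_of_tendsto hz (Eventually.of_forall fun i => ⟨v i, rfl⟩)
    exact ⟨b, (mc_isometry.isEmbedding.tendsto_nhds_iff).2 hz⟩
  have h1' : ∀ b : B, ∃ z : B, Tendsto (fun i => (u i).fst b) l (𝓝 z) := fun b =>
    key _ (by simpa only [mc_mul_coe] using h1 b)
  have h2' : ∀ b : B, ∃ z : B, Tendsto (fun i => (u i).snd b) l (𝓝 z) := fun b =>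
    key _ (by simpa only [mc_coe_mul] using h2 b)
  have mk : ∀ T : ι → B →L[ℂ] B, (∀ᶠ i in l, ‖T i‖ ≤ K) →
      (∀ b : B, ∃ z : B, Tendsto (fun i => T i b) l (𝓝 z)) →
      ∃ G : B →L[ℂ] B, ∀ b, Tendsto (fun i => T i b) l (𝓝 (G b)) := by
    intro T hT h
    choose g hg using h
    let G : B →ₗ[ℂ] B :=
      { toFun := g
        map_add' := fun a b => tendsto_nhds_unique (hg (a + b)) (by
          simpa using (hg a).add (hg b))
        map_smul' := fun t a => tendsto_nhds_unique (hg (t • a)) (by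
          simpa using (hg a).const_smul t) }
    refine ⟨G.mkContinuous K fun b => ?_, hg⟩
    refine le_of_tendsto (hg b).norm ?_
    filter_upwards [hT] with i hi
    exact ((T i).le_opNorm b).trans (by gcongr)
  obtain ⟨L, hL⟩ := mk (fun i => (u i).fst) (by simpa using hu) h1'
  obtain ⟨R, hR⟩ := mk (fun i => (u i).snd) (by simpa using hu) h2'
  refine ⟨⟨(L, R), fun x y => ?_⟩, fun b => ⟨?_, ?_⟩⟩
  · refine tendsto_nhds_unique ((hR x).mul_const y) ?_
    simpa only [DoubleCentralizer.central] using (hL y).const_mul x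
  · simp only [mc_mul_coe]
    exact (mc_isometry.isEmbedding.tendsto_nhds_iff).1 (hL b)
  · simp only [mc_coe_mul]
    exact (mc_isometry.isEmbedding.tendsto_nhds_iff).1 (hR b)

lemma cstrict_continuous_iff {C X : Type*} [NonUnitalCStarAlgebra C] (σ : C →⋆ₙₐ[ℂ] 𝓜(ℂ, B))
    {t : TopologicalSpace X} (f : X → 𝓜(ℂ, B)) :
    @Continuous _ _ t (cStrictUniformity σ).toTopologicalSpace f ↔
      ∀ d, Continuous (fun x => σ d * f x) ∧ Continuous (fun x => f x * σ d) := by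
  rw [cStrictUniformity, UniformSpace.toTopologicalSpace_iInf, continuous_iInf_rng]
  refine forall_congr' fun d => ?_
  exact continuous_inf_rng.trans (and_congr continuous_induced_rng continuous_induced_rng)

lemma cstrict_tendsto {C ι : Type*} [NonUnitalCStarAlgebra C] (σ : C →⋆ₙₐ[ℂ] 𝓜(ℂ, B))
    {l : Filter ι} (f : ι → 𝓜(ℂ, B)) (m : 𝓜(ℂ, B))
    (h : ∀ d, Tendsto (fun i => σ d * f i) l (𝓝 (σ d * m)) ∧
      Tendsto (fun i => f i * σ d) l (𝓝 (m * σ d))) :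
    Tendsto f l (@nhds _ (cStrictUniformity σ).toTopologicalSpace m) := by
  rw [cStrictUniformity, UniformSpace.toTopologicalSpace_iInf, nhds_iInf, tendsto_iInf]
  intro d
  change Tendsto f l (@nhds _ (TopologicalSpace.induced (fun m => σ d * m) inferInstance ⊓
    TopologicalSpace.induced (fun m => m * σ d) inferInstance) m)
  rw [@nhds_inf _ (TopologicalSpace.induced (fun m => σ d * m) inferInstance)
    (TopologicalSpace.induced (fun m => m * σ d) inferInstance) m, tendsto_inf]
  rw [@nhds_induced _ _ inferInstance (fun m => σ d * m) m,
    @nhds_induced _ _ inferInstance (fun m => m * σ d) m, tendsto_comap_iff, tendsto_comap_iff]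
  exact h d
end
end AuxLemmas

/-- Given nondegenerate `κ : C → M(A)`, `σ : D → M(B)`,
`λ : C → M(σ(D))` and a homomorphism `π : A → M_D(B)` with `π(κ(c)a) = λ(c)π(a)`, the map
`π` extends uniquely to a `C`-strict to `D`-strictly continuous homomorphism
`π̄ : M_C(A) → M_D(B)`, and moreover `π̄(κ̄(n)m) = λ̄(n)π̄(m)` and
`π̄(mκ̄(n)) = π̄(m)λ̄(n)` for `n ∈ M(C)`, `m ∈ M_C(A)`. -/
theorem stmt15 {A B C D : Type*} [NonUnitalCStarAlgebra A] [NonUnitalCStarAlgebra B]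
    [NonUnitalCStarAlgebra C] [NonUnitalCStarAlgebra D]
    (κ : C →⋆ₙₐ[ℂ] 𝓜(ℂ, A)) (σ : D →⋆ₙₐ[ℂ] 𝓜(ℂ, B)) (lam : C →⋆ₙₐ[ℂ] 𝓜(ℂ, B))
    (π : A →⋆ₙₐ[ℂ] 𝓜(ℂ, B))
    -- nondegeneracy of `κ` and `σ`
    (hκnd : ∀ a : A, (a : 𝓜(ℂ, A)) ∈ closure
      (Submodule.span ℂ {x : 𝓜(ℂ, A) | ∃ (c : C) (b : A), x = κ c * (b : 𝓜(ℂ, A))} :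
        Set 𝓜(ℂ, A)))
    (hσnd : ∀ b : B, (b : 𝓜(ℂ, B)) ∈ closure
      (Submodule.span ℂ {x : 𝓜(ℂ, B) | ∃ (d : D) (b' : B), x = σ d * (b' : 𝓜(ℂ, B))} :
        Set 𝓜(ℂ, B)))
    -- `λ` maps into the idealizer `M(σ(D))` of `σ(D)` in `M(B)` and is nondegenerate there
    (hlamid : ∀ (c : C) (d : D),
      (∃ d' : D, lam c * σ d = σ d') ∧ (∃ d' : D, σ d * lam c = σ d'))
    (hlamnd : ∀ d : D, σ d ∈ closure
      (Submodule.span ℂ {x : 𝓜(ℂ, B) | ∃ (c : C) (d' : D), x = lam c * σ d'} :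
        Set 𝓜(ℂ, B)))
    -- `π` maps into `M_D(B)`
    (hπD : ∀ a : A, π a ∈ MCset σ)
    -- the compatibility condition `π(κ(c)a) = λ(c)π(a)`
    (hcomp : ∀ (c : C) (a a' : A), κ c * (a : 𝓜(ℂ, A)) = (a' : 𝓜(ℂ, A)) →
      π a' = lam c * π a)
    -- the canonical (strictly continuous) extensions `κ̄` and `λ̄`
    (κbar : 𝓜(ℂ, C) →⋆ₙₐ[ℂ] 𝓜(ℂ, A)) (hκext : ∀ c : C, κbar ((c : 𝓜(ℂ, C))) = κ c)
    (hκbarcont : @Continuous _ _ (strictUniformity C).toTopologicalSpace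
      (strictUniformity A).toTopologicalSpace κbar)
    (lambar : 𝓜(ℂ, C) →⋆ₙₐ[ℂ] 𝓜(ℂ, B)) (hlamext : ∀ c : C, lambar ((c : 𝓜(ℂ, C))) = lam c)
    (hlambarcont : @Continuous _ _ (strictUniformity C).toTopologicalSpace
      (cStrictUniformity σ).toTopologicalSpace lambar) :
    ∃ f : MCset κ → 𝓜(ℂ, B),
      -- `f` is `C`-strict to `D`-strictly continuous and extends `π` ...
      (@Continuous _ _
          (TopologicalSpace.induced ((Subtype.val) : MCset κ → 𝓜(ℂ, A))
            (cStrictUniformity κ).toTopologicalSpace)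
          (cStrictUniformity σ).toTopologicalSpace f ∧
        ∀ (a : A) (ha : (a : 𝓜(ℂ, A)) ∈ MCset κ), f ⟨(a : 𝓜(ℂ, A)), ha⟩ = π a) ∧
      -- ... and is the unique such map
      (∀ g : MCset κ → 𝓜(ℂ, B),
        (@Continuous _ _
            (TopologicalSpace.induced ((Subtype.val) : MCset κ → 𝓜(ℂ, A))
              (cStrictUniformity κ).toTopologicalSpace)
            (cStrictUniformity σ).toTopologicalSpace g ∧
          ∀ (a : A) (ha : (a : 𝓜(ℂ, A)) ∈ MCset κ), g ⟨(a : 𝓜(ℂ, A)), ha⟩ = π a) → g = f) ∧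
      -- `f` maps into `M_D(B)`
      (∀ x : MCset κ, f x ∈ MCset σ) ∧
      -- `f` is a *-homomorphism
      (∀ x y z : MCset κ, (z : 𝓜(ℂ, A)) = (x : 𝓜(ℂ, A)) + y → f z = f x + f y) ∧
      (∀ x y z : MCset κ, (z : 𝓜(ℂ, A)) = (x : 𝓜(ℂ, A)) * y → f z = f x * f y) ∧
      (∀ x y : MCset κ, (y : 𝓜(ℂ, A)) = star (x : 𝓜(ℂ, A)) → f y = star (f x)) ∧
      (∀ (t : ℂ) (x y : MCset κ), (y : 𝓜(ℂ, A)) = t • (x : 𝓜(ℂ, A)) → f y = t • f x) ∧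
      -- the module identities with respect to `κ̄` and `λ̄`
      (∀ (n : 𝓜(ℂ, C)) (x : MCset κ),
        κbar n * (x : 𝓜(ℂ, A)) ∈ MCset κ ∧ (x : 𝓜(ℂ, A)) * κbar n ∈ MCset κ) ∧
      (∀ (n : 𝓜(ℂ, C)) (x y : MCset κ),
        (y : 𝓜(ℂ, A)) = κbar n * (x : 𝓜(ℂ, A)) → f y = lambar n * f x) ∧
      (∀ (n : 𝓜(ℂ, C)) (x y : MCset κ),
        (y : 𝓜(ℂ, A)) = (x : 𝓜(ℂ, A)) * κbar n → f y = f x * lambar n) := by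
  classical
  -- right version of the compatibility condition
  have hcompr : ∀ (c : C) (a a' : A), (a : 𝓜(ℂ, A)) * κ c = (a' : 𝓜(ℂ, A)) →
      π a' = π a * lam c := by
    intro c a a' h
    have h1 := hcomp (star c) (star a) (star a') (by
      rw [map_star, ← mc_coe_star, ← mc_coe_star, ← star_mul, h])
    rw [map_star, map_star, map_star, ← star_mul] at h1
    exact star_injective h1
  have hκl : ∀ a : A, Filter.Tendsto (fun e => κ e * (a : 𝓜(ℂ, A))) (auF C) (nhds (a : 𝓜(ℂ, A))) :=
    fun a => aux_au_left κ _ (by rintro x ⟨c, b, rfl⟩; exact ⟨c, b, rfl⟩) (hκnd a)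
  have hσl : ∀ b : B, ∃ x d, (b : 𝓜(ℂ, B)) = σ d * x := fun b =>
    aux_fact_left σ (aux_au_left σ _ (by rintro x ⟨c, b, rfl⟩; exact ⟨c, b, rfl⟩) (hσnd b))
  have hdt : ∀ d : D, Filter.Tendsto (fun e => lam e * σ d) (auF C) (nhds (σ d)) := fun d =>
    aux_au_left lam _ (by rintro x ⟨c, b, rfl⟩; exact ⟨c, σ b, rfl⟩) (hlamnd d)
  have hdL : ∀ d : D, ∃ x c, σ d = lam c * x := fun d => aux_fact_left lam (hdt d)
  have hdR : ∀ d : D, ∃ x c, σ d = x * lam c := fun d =>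
    aux_fact_right lam (aux_au_star lam (by rw [← map_star]; exact hdt (star d)))
  have hbσR : ∀ b : B, ∃ x d, (b : 𝓜(ℂ, B)) = x * σ d := by
    intro b
    obtain ⟨x, d, h⟩ := hσl (star b)
    refine ⟨star x, star d, ?_⟩
    rw [map_star, ← star_mul, ← h, mc_coe_star, star_star]
  have hbL : ∀ b : B, ∃ x c, (b : 𝓜(ℂ, B)) = lam c * x := by
    intro b
    obtain ⟨x, d, h⟩ := hσl b
    obtain ⟨y, c, h'⟩ := hdL d
    exact ⟨y * x, c, by rw [h, h', mul_assoc]⟩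
  have hbR : ∀ b : B, ∃ x c, (b : 𝓜(ℂ, B)) = x * lam c := by
    intro b
    obtain ⟨x, d, h⟩ := hbσR b
    obtain ⟨y, c, h'⟩ := hdR d
    exact ⟨x * y, c, by rw [h, h', mul_assoc]⟩
  have cancR : ∀ x y : 𝓜(ℂ, B), (∀ c, x * lam c = y * lam c) → x = y := by
    intro x y h
    refine mc_ext fun b => ?_
    obtain ⟨z, c, hz⟩ := hbL b
    rw [hz, ← mul_assoc, ← mul_assoc, h]
  have cancL : ∀ x y : 𝓜(ℂ, B), (∀ c, lam c * x = lam c * y) → x = y := by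
    intro x y h
    refine mc_ext' fun b => ?_
    obtain ⟨z, c, hz⟩ := hbR b
    rw [hz, mul_assoc, mul_assoc, h]
  have hπt : ∀ (v : C → A) (a : A), Filter.Tendsto (fun e => (v e : 𝓜(ℂ, A))) (auF C)
      (nhds (a : 𝓜(ℂ, A))) → Filter.Tendsto (fun e => π (v e)) (auF C) (nhds (π a)) := by
    intro v a h
    exact ((aux_cont_s15 π).tendsto a).comp ((mc_isometry.isEmbedding.tendsto_nhds_iff).2 h)
  have hκt : ∀ (c : C) (m : 𝓜(ℂ, A)), Filter.Tendsto (fun e => κ (c * e) * m) (auF C)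
      (nhds (κ c * m)) := fun c m =>
    (((aux_cont_s15 κ).tendsto c).comp ((auF_spec C).1.tendsto_mul_left c)).mul_const m
  -- construction
  have hF : ∀ m : MCset κ, ∃ F : 𝓜(ℂ, B),
      (∀ (c : C) (a : A), (m : 𝓜(ℂ, A)) * κ c = a → F * lam c = π a) ∧
      (∀ (c : C) (a : A), κ c * (m : 𝓜(ℂ, A)) = a → lam c * F = π a) := by
    rintro ⟨m, hm⟩
    choose p hp using fun c => (hm c).1
    have hright : ∀ (c : C) (a : A), m * κ c = a →
        Filter.Tendsto (fun e => π (p e) * lam c) (auF C) (nhds (π a)) := by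
      intro c a ha
      have h1 := hπt (fun e => (κ e).fst a) a (by simpa only [mc_mul_coe] using hκl a)
      refine h1.congr fun e => ?_
      exact hcompr c _ _ (by rw [← hp, mul_assoc, ha, mc_mul_coe])
    have hleft : ∀ (c : C) (a : A), κ c * m = a →
        Filter.Tendsto (fun e => lam c * π (p e)) (auF C) (nhds (π a)) := by
      intro c a ha
      have h1 := hπt (fun e => p (c * e)) a (by
        simp only [← hp]; rw [← ha]; exact hκt c m)
      refine h1.congr fun e => ?_
      exact hcomp c _ _ (by rw [← hp, ← hp, map_mul, mul_assoc])
    obtain ⟨F, hF⟩ := mc_limit (l := auF C) (fun e => π (p e)) (K := ‖m‖) (by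
        filter_upwards [(auF_spec C).2] with e he
        refine (NonUnitalStarAlgHom.norm_apply_le π _).trans ?_
        have h1 : ‖(p e : 𝓜(ℂ, A))‖ = ‖p e‖ :=
          NonUnitalStarAlgHom.norm_map (DoubleCentralizer.coeHom (𝕜 := ℂ) (A := A)) mc_coe_inj (p e)
        rw [← h1, ← hp]
        refine (norm_mul_le _ _).trans ?_
        exact mul_le_of_le_one_left (norm_nonneg _)
          ((NonUnitalStarAlgHom.norm_apply_le κ e).trans he.1))
      (by
        intro b
        obtain ⟨x, c, h⟩ := hbL b
        obtain ⟨a, ha⟩ := (hm c).2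
        refine ⟨π a * x, ?_⟩
        simp only [h, ← mul_assoc]
        exact (hright c a ha).mul_const x)
      (by
        intro b
        obtain ⟨x, c, h⟩ := hbR b
        obtain ⟨a, ha⟩ := (hm c).1
        refine ⟨x * π a, ?_⟩
        simp only [h, mul_assoc]
        exact (hleft c a ha).const_mul x)
    refine ⟨F, fun c a ha => mc_ext fun b => ?_, fun c a ha => mc_ext' fun b => ?_⟩
    · have h1 := (hF ((lam c).fst b)).1
      rw [← mc_mul_coe] at h1
      refine tendsto_nhds_unique (by simpa only [← mul_assoc] using h1)
        ((hright c a ha).mul_const _)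
    · have h1 := (hF ((lam c).snd b)).2
      rw [← mc_coe_mul] at h1
      refine tendsto_nhds_unique (by simpa only [mul_assoc] using h1)
        ((hleft c a ha).const_mul _)
  choose f hfR hfL using hF
  have hcont : @Continuous _ _
          (TopologicalSpace.induced ((Subtype.val) : MCset κ → 𝓜(ℂ, A))
            (cStrictUniformity κ).toTopologicalSpace)
          (cStrictUniformity σ).toTopologicalSpace f := by
    let τ : TopologicalSpace (MCset κ) :=
      (TopologicalSpace.induced ((Subtype.val) : MCset κ → 𝓜(ℂ, A))
            (cStrictUniformity κ).toTopologicalSpace)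
    have hid := (cstrict_continuous_iff κ (t := τ) Subtype.val).1 continuous_induced_dom
    rw [cstrict_continuous_iff]
    intro d
    constructor
    · obtain ⟨x, c, h⟩ := hdR d
      choose a ha using fun m : MCset κ => (m.2 c).1
      have h1 : Continuous a := by
        refine mc_isometry.isEmbedding.continuous_iff.2 ((hid c).1.congr ha)
      have h2 : (fun m => σ d * f m) = fun m => x * π (a m) := by
        funext m
        rw [h, mul_assoc, hfL m c _ (ha m)]
      rw [h2]
      exact continuous_const.mul ((aux_cont_s15 π).comp h1)
    · obtain ⟨x, c, h⟩ := hdL d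
      choose a ha using fun m : MCset κ => (m.2 c).2
      have h1 : Continuous a := by
        refine mc_isometry.isEmbedding.continuous_iff.2 ((hid c).2.congr ha)
      have h2 : (fun m => f m * σ d) = fun m => π (a m) * x := by
        funext m
        rw [h, ← mul_assoc, hfR m c _ (ha m)]
      rw [h2]
      exact ((aux_cont_s15 π).comp h1).mul continuous_const
  have hext : ∀ (a : A) (ha : (a : 𝓜(ℂ, A)) ∈ MCset κ), f ⟨(a : 𝓜(ℂ, A)), ha⟩ = π a := by
    intro a ha
    refine cancR _ _ fun c => ?_
    obtain ⟨a', h⟩ := (ha c).2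
    rw [hfR _ c a' h, hcompr c a a' h]
  have hcoemem : ∀ a : A, (a : 𝓜(ℂ, A)) ∈ MCset κ := fun a c =>
    ⟨⟨_, mc_mul_coe _ _⟩, ⟨_, mc_coe_mul _ _⟩⟩
  have hadd : ∀ a b : A, ((a + b : A) : 𝓜(ℂ, A)) = (a : 𝓜(ℂ, A)) + (b : 𝓜(ℂ, A)) :=
    map_add (DoubleCentralizer.coeHom (𝕜 := ℂ) (A := A))
  have hmul : ∀ a b : A, ((a * b : A) : 𝓜(ℂ, A)) = (a : 𝓜(ℂ, A)) * (b : 𝓜(ℂ, A)) :=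
    map_mul (DoubleCentralizer.coeHom (𝕜 := ℂ) (A := A))
  have hsmul : ∀ (t : ℂ) (a : A), ((t • a : A) : 𝓜(ℂ, A)) = t • (a : 𝓜(ℂ, A)) :=
    map_smul (DoubleCentralizer.coeHom (𝕜 := ℂ) (A := A))
  have hfπ : ∀ (x : MCset κ) (a b : A), (x : 𝓜(ℂ, A)) * a = b → f x * π a = π b := by
    intro x a b h
    refine cancL _ _ fun c => ?_
    obtain ⟨a', h'⟩ := (x.2 c).1
    rw [← mul_assoc, hfL x c a' h', ← map_mul]
    exact hcomp c b _ (by rw [← h, ← mul_assoc, h', hmul])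
  have hκn : ∀ (c : C) (n : 𝓜(ℂ, C)), κ c * κbar n = κ (n.snd c) := fun c n => by
    rw [← hκext, ← hκext, ← map_mul, mc_coe_mul]
  have hnκ : ∀ (c : C) (n : 𝓜(ℂ, C)), κbar n * κ c = κ (n.fst c) := fun c n => by
    rw [← hκext, ← hκext, ← map_mul, mc_mul_coe]
  have hln : ∀ (c : C) (n : 𝓜(ℂ, C)), lam c * lambar n = lam (n.snd c) := fun c n => by
    rw [← hlamext, ← hlamext, ← map_mul, mc_coe_mul]
  have hnl : ∀ (c : C) (n : 𝓜(ℂ, C)), lambar n * lam c = lam (n.fst c) := fun c n => by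
    rw [← hlamext, ← hlamext, ← map_mul, mc_mul_coe]
  refine ⟨f, ⟨hcont, hext⟩, ?_, ?_, ?_, ?_, ?_, ?_, ?_, ?_, ?_⟩
  · rintro g ⟨hg, hgext⟩
    funext x
    choose p hp using fun c => (x.2 c).1
    let v : C → MCset κ := fun e => ⟨(p e : 𝓜(ℂ, A)), hcoemem _⟩
    let τ : TopologicalSpace (MCset κ) :=
      (TopologicalSpace.induced ((Subtype.val) : MCset κ → 𝓜(ℂ, A))
            (cStrictUniformity κ).toTopologicalSpace)
    have hv : Filter.Tendsto v (auF C) (nhds x) := by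
      rw [@nhds_induced _ _ (cStrictUniformity κ).toTopologicalSpace Subtype.val x,
        Filter.tendsto_comap_iff]
      refine cstrict_tendsto κ _ _ fun c => ⟨?_, ?_⟩
      · refine (hκt c x).congr fun e => ?_
        change _ = κ c * (p e : 𝓜(ℂ, A))
        rw [← hp, map_mul, mul_assoc]
      · obtain ⟨a, ha⟩ := (x.2 c).2
        rw [ha]
        refine (hκl a).congr fun e => ?_
        change _ = (p e : 𝓜(ℂ, A)) * κ c
        rw [← hp, mul_assoc, ha]
    rw [cstrict_continuous_iff] at hg hcont
    refine mc_ext' fun b => ?_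
    obtain ⟨z, d, hz⟩ := hbσR b
    rw [hz, mul_assoc, mul_assoc]
    congr 1
    refine tendsto_nhds_unique (((hg d).1.tendsto x).comp hv) ?_
    refine (((hcont d).1.tendsto x).comp hv).congr fun e => ?_
    change σ d * f (v e) = σ d * g (v e)
    rw [hext, hgext]
  · intro x d
    constructor
    · obtain ⟨z, c, h⟩ := hdR d
      have hcl : σ d * f x ∈ Set.range (fun b : B => (b : 𝓜(ℂ, B))) := by
        have h1 : Filter.Tendsto (fun e => σ d * lam e) (auF C) (nhds (σ d)) :=
          aux_au_star lam (by rw [← map_star]; exact hdt (star d))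
        refine mc_closed.mem_of_tendsto (h1.mul_const (f x)) (Filter.Eventually.of_forall fun e => ?_)
        obtain ⟨a, ha⟩ := (x.2 e).1
        obtain ⟨b, hb⟩ := (hπD a d).1
        exact ⟨b, by rw [mul_assoc, hfL x e a ha, hb]⟩
      obtain ⟨b, hb⟩ := hcl
      exact ⟨b, hb.symm⟩
    · have hcl : f x * σ d ∈ Set.range (fun b : B => (b : 𝓜(ℂ, B))) := by
        refine mc_closed.mem_of_tendsto ((hdt d).const_mul (f x))
          (Filter.Eventually.of_forall fun e => ?_)
        obtain ⟨a, ha⟩ := (x.2 e).2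
        obtain ⟨b, hb⟩ := (hπD a d).2
        exact ⟨b, by rw [← mul_assoc, hfR x e a ha, hb]⟩
      obtain ⟨b, hb⟩ := hcl
      exact ⟨b, hb.symm⟩
  · intro x y z h
    refine cancR _ _ fun c => ?_
    obtain ⟨a, ha⟩ := (x.2 c).2
    obtain ⟨b, hb⟩ := (y.2 c).2
    rw [add_mul, hfR x c a ha, hfR y c b hb, ← map_add]
    exact hfR z c _ (by rw [h, add_mul, ha, hb, hadd])
  · intro x y z h
    refine cancR _ _ fun c => ?_
    obtain ⟨a, ha⟩ := (z.2 c).2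
    obtain ⟨b, hb⟩ := (y.2 c).2
    rw [mul_assoc, hfR z c a ha, hfR y c b hb]
    exact (hfπ x b a (by rw [← hb, ← mul_assoc, ← h, ha])).symm
  · intro x y h
    refine cancR _ _ fun c => ?_
    obtain ⟨a, ha⟩ := (x.2 (star c)).1
    have h1 := congrArg star (hfL x (star c) a ha)
    rw [star_mul, map_star, star_star] at h1
    rw [h1, ← map_star]
    refine hfR y c _ ?_
    rw [h, ← mc_coe_star, ← ha, star_mul, map_star, star_star]
  · intro t x y h
    refine cancR _ _ fun c => ?_
    obtain ⟨a, ha⟩ := (x.2 c).2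
    rw [smul_mul_assoc, hfR x c a ha, ← map_smul]
    exact hfR y c _ (by rw [h, smul_mul_assoc, ha, hsmul])
  · intro n x
    refine ⟨fun c => ⟨?_, ?_⟩, fun c => ⟨?_, ?_⟩⟩
    · rw [← mul_assoc, hκn]; exact (x.2 _).1
    · obtain ⟨a, ha⟩ := (x.2 c).2
      exact ⟨_, by rw [mul_assoc, ha, mc_mul_coe]⟩
    · obtain ⟨a, ha⟩ := (x.2 c).1
      exact ⟨_, by rw [← mul_assoc, ha, mc_coe_mul]⟩
    · rw [mul_assoc, hnκ]; exact (x.2 _).2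
  · intro n x y h
    refine cancL _ _ fun c => ?_
    obtain ⟨a, ha⟩ := (y.2 c).1
    rw [hfL y c a ha, ← mul_assoc, hln]
    exact (hfL x _ a (by rw [← ha, h, ← mul_assoc, hκn])).symm
  · intro n x y h
    refine cancR _ _ fun c => ?_
    obtain ⟨a, ha⟩ := (y.2 c).2
    rw [hfR y c a ha, mul_assoc, hnl]
    exact (hfR x _ a (by rw [← ha, h, mul_assoc, hnκ])).symm
end
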